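/- For every natural number n ≥ 1, g_0(n+1) > g_0(n). -/

import Mathlib

open Finset

/-- λ = 2 + √3 -/
noncomputable def lam : ℝ := 2 + Real.sqrt 3

/-- A_k = (λ^k + λ^{-k}) / 2 -/
noncomputable def A (k : ℕ) : ℝ := (lam ^ k + lam⁻¹ ^ k) / 2

/-- B_k = (λ^k - λ^{-k}) / (2√3) -/
noncomputable def B (k : ℕ) : ℝ := (lam ^ k - lam⁻¹ ^ k) / (2 * Real.sqrt 3)

/-- φ(t) = (1 + t²)/(1 + t)² -/
noncomputable def phi (t : ℝ) : ℝ := (1 + t ^ 2) / (1 + t) ^ 2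

/-- g_k(n) = (1/B_n)·(A_{n-k}·Σ_{j<k}(A_{j+1}+A_j)φ(A_{j+1}/A_j)
              + A_k·Σ_{j<n-k}(A_{j+1}+A_j)φ(A_{j+1}/A_j)) -/
noncomputable def g (k n : ℕ) : ℝ :=
  (1 / B n) *
    (A (n - k) * ∑ j ∈ Finset.range k, (A (j + 1) + A j) * phi (A (j + 1) / A j)
      + A k * ∑ j ∈ Finset.range (n - k), (A (j + 1) + A j) * phi (A (j + 1) / A j))

lemma inv_lam : lam⁻¹ = 2 - Real.sqrt 3 := by
  refine inv_eq_of_mul_eq_one_right ?_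
  have h : Real.sqrt 3 * Real.sqrt 3 = 3 := Real.mul_self_sqrt (by norm_num)
  unfold lam
  linear_combination -h

lemma A_zero : A 0 = 1 := by simp [A]

lemma B_zero : B 0 = 0 := by simp [B]

lemma A_succ (n : ℕ) : A (n + 1) = 2 * A n + 3 * B n := by
  have h : Real.sqrt 3 * Real.sqrt 3 = 3 := Real.mul_self_sqrt (by norm_num)
  have h0 : Real.sqrt 3 ≠ 0 := by positivity
  unfold A B
  rw [pow_succ, pow_succ, inv_lam]
  generalize (2 - Real.sqrt 3) ^ n = y
  generalize lam ^ n = x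
  unfold lam
  field_simp
  linear_combination (x - y) * h

lemma B_succ (n : ℕ) : B (n + 1) = A n + 2 * B n := by
  have h0 : Real.sqrt 3 ≠ 0 := by positivity
  unfold A B
  rw [pow_succ, pow_succ, inv_lam]
  generalize (2 - Real.sqrt 3) ^ n = y
  generalize lam ^ n = x
  unfold lam
  field_simp
  ring

lemma A_pos_and_B_nonneg (n : ℕ) : 0 < A n ∧ 0 ≤ B n := by
  induction n with
  | zero => simp [A_zero, B_zero]
  | succ n ih =>
    obtain ⟨hA, hB⟩ := ih
    rw [A_succ, B_succ]
    constructor <;> positivity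

lemma A_pos (n : ℕ) : 0 < A n := (A_pos_and_B_nonneg n).1

lemma B_nonneg (n : ℕ) : 0 ≤ B n := (A_pos_and_B_nonneg n).2

lemma B_succ_pos (n : ℕ) : 0 < B (n + 1) := by
  rw [B_succ]
  linarith [A_pos n, B_nonneg n]

lemma A_sq_sub_three_mul_B_sq (n : ℕ) : A n ^ 2 - 3 * B n ^ 2 = 1 := by
  induction n with
  | zero => simp [A_zero, B_zero]
  | succ n ih =>
    rw [A_succ, B_succ]
    linear_combination ih

lemma phi_lt_phi {s t : ℝ} (hs : 1 ≤ s) (hst : s < t) : phi s < phi t := by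
  unfold phi
  rw [div_lt_div_iff₀ (by positivity) (pow_pos (by linarith) 2)]
  have h : 0 < (t - s) * (s * t - 1) := mul_pos (by linarith) (by nlinarith)
  linarith

lemma phi_A_ratio_lt (n : ℕ) :
    phi (A (n + 1) / A n) < phi (A (n + 1 + 1) / A (n + 1)) := by
  have hA := A_pos n
  have hB := B_nonneg n
  apply phi_lt_phi
  · rw [one_le_div hA, A_succ]
    linarith
  · rw [div_lt_div_iff₀ hA (A_pos _), A_succ (n + 1), A_succ, B_succ]
    linarith [A_sq_sub_three_mul_B_sq n]

lemma A_succ_add_A (n : ℕ) : A (n + 1) + A n = 3 * (B (n + 1) - B n) := by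
  rw [A_succ, B_succ]
  ring

lemma sum_lt_three_mul_B_mul_phi (n : ℕ) :
    ∑ j ∈ Finset.range (n + 1), (A (j + 1) + A j) * phi (A (j + 1) / A j)
      < 3 * B (n + 1) * phi (A (n + 1 + 1) / A (n + 1)) := by
  have step (m : ℕ) : 3 * B (m + 1) * phi (A (m + 1) / A m)
      < 3 * B (m + 1) * phi (A (m + 1 + 1) / A (m + 1)) :=
    mul_lt_mul_of_pos_left (phi_A_ratio_lt m) (by linarith [B_succ_pos m])
  induction n with
  | zero =>
    rw [Finset.sum_range_one, A_succ_add_A, B_zero, sub_zero]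
    exact step 0
  | succ n ih =>
    rw [Finset.sum_range_succ, A_succ_add_A]
    linarith [step (n + 1)]

lemma g_zero_left (n : ℕ) :
    g 0 n = (∑ j ∈ Finset.range n, (A (j + 1) + A j) * phi (A (j + 1) / A j)) / B n := by
  simp [g, A_zero, div_eq_inv_mul]

theorem g_zero_strict_mono (n : ℕ) (hn : 1 ≤ n) : g 0 (n + 1) > g 0 n := by
  obtain ⟨m, rfl⟩ := Nat.exists_eq_add_of_le' hn
  have hA := A_pos (m + 1)
  have hB := B_succ_pos m
  have hsum := sum_lt_three_mul_B_mul_phi m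
  rw [gt_iff_lt, g_zero_left, g_zero_left, div_lt_div_iff₀ hB (B_succ_pos _),
    Finset.sum_range_succ _ (m + 1), A_succ_add_A]
  have hdiff : 0 < B (m + 1 + 1) - B (m + 1) := by
    rw [B_succ (m + 1)]
    linarith
  linarith [mul_lt_mul_of_pos_right hsum hdiff]
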